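/- Let M = (Q, W, R) be a hereditary abelian model structure on an abelian category A. For an object A, the following are equivalent: (1) A is cofibrant (A ∈ Q); (2) every cycle object of any M-resolution W_A of A lies in Q; (3) Hom_A(W_A, R) is an exact complex for every M-resolution W_A of A and every trivially fibrant object R ∈ W ∩ R; (4) every component of any M-resolution W_A of A lies in Q ∩ W. -/

import Mathlib

open CategoryTheory CategoryTheory.Limits

universe w v u

variable {C : Type u} [Category.{v} C] [Abelian C]

/-- A hereditary abelian model structure (Hovey triple) `(𝒬, 𝒲, ℛ)` on an abelian
category: `𝒲` is thick, `(𝒬, 𝒲 ∩ ℛ)` and `(𝒬 ∩ 𝒲, ℛ)` are complete cotorsion pairs, and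
both cotorsion pairs are hereditary (`Extⁱ` vanishes for all `i ≥ 1`). -/
structure HoveyTriple (C : Type u) [Category.{v} C] [Abelian C] [HasExt.{w} C] where
  Q : C → Prop
  W : C → Prop
  R : C → Prop
  /-- `𝒲` is closed under retracts. -/
  thick_retract : ∀ ⦃X Y : C⦄, (∃ (s : Y ⟶ X) (r : X ⟶ Y), s ≫ r = 𝟙 Y) → W X → W Y
  /-- `𝒲` satisfies the two-out-of-three property on short exact sequences. -/
  thick_two_of_three : ∀ ⦃X Y Z : C⦄ (i : X ⟶ Y) (p : Y ⟶ Z) (w : i ≫ p = 0),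
    (ShortComplex.mk i p w).ShortExact →
      ((W X → W Y → W Z) ∧ (W X → W Z → W Y) ∧ (W Y → W Z → W X))
  /-- `Ext¹`-orthogonality of `𝒬` and `𝒲 ∩ ℛ`. -/
  orth₁ : ∀ ⦃X Y : C⦄, Q X → W Y → R Y → Subsingleton (Abelian.Ext X Y 1)
  orth₁_left : ∀ ⦃X : C⦄, (∀ Y : C, W Y → R Y → Subsingleton (Abelian.Ext X Y 1)) → Q X
  orth₁_right : ∀ ⦃Y : C⦄, (∀ X : C, Q X → Subsingleton (Abelian.Ext X Y 1)) → W Y ∧ R Y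
  /-- `Ext¹`-orthogonality of `𝒬 ∩ 𝒲` and `ℛ`. -/
  orth₂ : ∀ ⦃X Y : C⦄, Q X → W X → R Y → Subsingleton (Abelian.Ext X Y 1)
  orth₂_left : ∀ ⦃X : C⦄, (∀ Y : C, R Y → Subsingleton (Abelian.Ext X Y 1)) → Q X ∧ W X
  orth₂_right : ∀ ⦃Y : C⦄, (∀ X : C, Q X → W X → Subsingleton (Abelian.Ext X Y 1)) → R Y
  /-- the cotorsion pair `(𝒬, 𝒲 ∩ ℛ)` has enough projectives. -/
  complete₁_proj : ∀ A : C, ∃ (K E : C) (i : K ⟶ E) (p : E ⟶ A) (w : i ≫ p = 0),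
    Q E ∧ W K ∧ R K ∧ (ShortComplex.mk i p w).ShortExact
  /-- the cotorsion pair `(𝒬, 𝒲 ∩ ℛ)` has enough injectives. -/
  complete₁_inj : ∀ A : C, ∃ (E K : C) (i : A ⟶ E) (p : E ⟶ K) (w : i ≫ p = 0),
    W E ∧ R E ∧ Q K ∧ (ShortComplex.mk i p w).ShortExact
  /-- the cotorsion pair `(𝒬 ∩ 𝒲, ℛ)` has enough projectives. -/
  complete₂_proj : ∀ A : C, ∃ (K E : C) (i : K ⟶ E) (p : E ⟶ A) (w : i ≫ p = 0),
    Q E ∧ W E ∧ R K ∧ (ShortComplex.mk i p w).ShortExact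
  /-- the cotorsion pair `(𝒬 ∩ 𝒲, ℛ)` has enough injectives. -/
  complete₂_inj : ∀ A : C, ∃ (E K : C) (i : A ⟶ E) (p : E ⟶ K) (w : i ≫ p = 0),
    R E ∧ Q K ∧ W K ∧ (ShortComplex.mk i p w).ShortExact
  /-- heredity of `(𝒬, 𝒲 ∩ ℛ)`. -/
  hereditary₁ : ∀ ⦃X Y : C⦄ (i : ℕ), 1 ≤ i → Q X → W Y → R Y →
    Subsingleton (Abelian.Ext X Y i)
  /-- heredity of `(𝒬 ∩ 𝒲, ℛ)`. -/
  hereditary₂ : ∀ ⦃X Y : C⦄ (i : ℕ), 1 ≤ i → Q X → W X → R Y →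
    Subsingleton (Abelian.Ext X Y i)

variable [HasExt.{w} C]

/-- An `𝔐`-resolution of `A`: an everywhere-exact `ℤ`-indexed complex obtained by splicing
a resolution of `A` with components in `𝒬 ∩ 𝒲` and kernels in `ℛ` together with a
coresolution of `A` with components in `𝒲 ∩ ℛ` and cokernels in `𝒬`. -/
structure MResolution (M : HoveyTriple.{w} C) (A : C) where
  c : ChainComplex C ℤ
  ε : c.X 0 ⟶ A
  η : A ⟶ c.X (-1)
  epi : Epi ε
  mono : Mono η
  fac : c.d 0 (-1) = ε ≫ η
  comp_pos : ∀ n : ℤ, 0 ≤ n → M.Q (c.X n) ∧ M.W (c.X n)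
  comp_neg : ∀ n : ℤ, n < 0 → M.W (c.X n) ∧ M.R (c.X n)
  exact : ∀ n : ℤ, (ShortComplex.mk (c.d (n + 1) n) (c.d n (n - 1)) (c.d_comp_d _ _ _)).Exact
  ker_eps : M.R (kernel ε)
  ker_d : ∀ n : ℤ, 1 ≤ n → M.R (kernel (c.d n (n - 1)))
  cok_eta : M.Q (cokernel η)
  cok_d : ∀ n : ℤ, n ≤ -1 → M.Q (cokernel (c.d n (n - 1)))



section Helpers

open Abelian

lemma Q_of_iso (M : HoveyTriple.{w} C) {X Y : C} (e : X ≅ Y) (h : M.Q X) : M.Q Y := by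
  apply M.orth₁_left
  intro T hT hT'
  have := M.orth₁ h hT hT'
  refine ⟨fun a b => ?_⟩
  have key : ∀ a : Ext Y T 1, a = 0 := by
    intro a
    have h1 : (Ext.mk₀ e.hom).comp a (zero_add 1) = 0 := Subsingleton.elim _ _
    have h2 := congrArg (fun t => (Ext.mk₀ e.inv).comp t (zero_add 1)) h1
    simpa using h2
  rw [key a, key b]

lemma R_of_iso (M : HoveyTriple.{w} C) {X Y : C} (e : X ≅ Y) (h : M.R X) : M.R Y := by
  apply M.orth₂_right
  intro T hT hT'
  have := M.orth₂ hT hT' h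
  refine ⟨fun a b => ?_⟩
  have key : ∀ a : Ext T Y 1, a = 0 := by
    intro a
    have h1 : a.comp (Ext.mk₀ e.inv) (add_zero 1) = 0 := Subsingleton.elim _ _
    have h2 := congrArg (fun t => t.comp (Ext.mk₀ e.hom) (add_zero 1)) h1
    simpa [Ext.comp_assoc_of_third_deg_zero] using h2
  rw [key a, key b]

lemma Q_kernel (M : HoveyTriple.{w} C) {S : ShortComplex C} (hS : S.ShortExact)
    (h2 : M.Q S.X₂) (h3 : M.Q S.X₃) : M.Q S.X₁ := by
  apply M.orth₁_left
  intro T hT hT'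
  have := M.orth₁ h2 hT hT'
  have := M.hereditary₁ 2 (by norm_num) h3 hT hT'
  refine ⟨fun a b => ?_⟩
  have key : ∀ a : Ext S.X₁ T 1, a = 0 := by
    intro a
    obtain ⟨x, rfl⟩ := Ext.contravariant_sequence_exact₁ hS T a (n₁ := 2) rfl
      (Subsingleton.elim _ _)
    rw [Subsingleton.elim x 0, Ext.comp_zero]
  rw [key a, key b]

lemma Q_ext (M : HoveyTriple.{w} C) {S : ShortComplex C} (hS : S.ShortExact)
    (h1 : M.Q S.X₁) (h3 : M.Q S.X₃) : M.Q S.X₂ := by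
  apply M.orth₁_left
  intro T hT hT'
  have := M.orth₁ h1 hT hT'
  have := M.orth₁ h3 hT hT'
  refine ⟨fun a b => ?_⟩
  have key : ∀ a : Ext S.X₂ T 1, a = 0 := by
    intro a
    obtain ⟨x, rfl⟩ := Ext.contravariant_sequence_exact₂ hS T a
      (Subsingleton.elim _ _)
    rw [Subsingleton.elim x 0, Ext.comp_zero]
  rw [key a, key b]

/-- extension of maps along a monomorphism with cokernel orthogonal to the target -/
lemma extend_of_ext {S : ShortComplex C} (hS : S.ShortExact) {T : C}
    [Subsingleton (Ext S.X₃ T 1)] (f : S.X₁ ⟶ T) : ∃ g : S.X₂ ⟶ T, S.f ≫ g = f := by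
  obtain ⟨x, hx⟩ := Ext.contravariant_sequence_exact₁ hS T (Ext.mk₀ f) (n₁ := 1) rfl
    (Subsingleton.elim _ _)
  obtain ⟨g, rfl⟩ := (Ext.mk₀_bijective _ _).2 x
  rw [Ext.mk₀_comp_mk₀] at hx
  exact ⟨g, (Ext.mk₀_bijective _ _).1 hx⟩

lemma Q_of_extend (M : HoveyTriple.{w} C) {S : ShortComplex C} (hS : S.ShortExact)
    (h2 : M.Q S.X₂)
    (H : ∀ T : C, M.W T → M.R T → ∀ f : S.X₁ ⟶ T, ∃ g : S.X₂ ⟶ T, S.f ≫ g = f) :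
    M.Q S.X₃ := by
  apply M.orth₁_left
  intro T hT hT'
  have := M.orth₁ h2 hT hT'
  refine ⟨fun a b => ?_⟩
  have key : ∀ a : Ext S.X₃ T 1, a = 0 := by
    intro a
    obtain ⟨x, rfl⟩ := Ext.contravariant_sequence_exact₃ hS T a
      (Subsingleton.elim _ _) (n₀ := 0) rfl
    obtain ⟨f, rfl⟩ := (Ext.mk₀_bijective _ _).2 x
    obtain ⟨g, rfl⟩ := H T hT hT' f
    rw [← Ext.mk₀_comp_mk₀]
    exact ShortComplex.ShortExact.extClass_comp_assoc hS _
  rw [key a, key b]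

lemma ses_of_exact {X Y Z : C} (f : X ⟶ Y) (g : Y ⟶ Z) (w : f ≫ g = 0)
    (h : (ShortComplex.mk f g w).Exact) :
    (ShortComplex.mk (kernel.ι f) (kernel.lift g f w) (by
      rw [← cancel_mono (kernel.ι g)]; simp)).ShortExact := by
  have : Epi (kernel.lift g f w) := (ShortComplex.exact_iff_epi_kernel_lift _).1 h
  refine ShortComplex.ShortExact.mk' ?_ inferInstance this
  let φ : ShortComplex.mk (kernel.ι f) (kernel.lift g f w) (by
      rw [← cancel_mono (kernel.ι g)]; simp) ⟶ ShortComplex.mk (kernel.ι f) f (by simp) :=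
    { τ₁ := 𝟙 _, τ₂ := 𝟙 _, τ₃ := kernel.ι g }
  have : Epi φ.τ₁ := inferInstanceAs (Epi (𝟙 _))
  have : IsIso φ.τ₂ := inferInstanceAs (IsIso (𝟙 _))
  have : Mono φ.τ₃ := inferInstanceAs (Mono (kernel.ι g))
  exact (ShortComplex.exact_iff_of_epi_of_isIso_of_mono φ).2 (ShortComplex.exact_kernel f)

lemma coker_iso_ker {X Y Z T : C} (f : X ⟶ Y) (g : Y ⟶ Z) (h : Z ⟶ T) (w : f ≫ g = 0)
    (w' : g ≫ h = 0)
    (e : (ShortComplex.mk f g w).Exact) (e' : (ShortComplex.mk g h w').Exact) :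
    Nonempty (cokernel f ≅ kernel h) := by
  have hepi : Epi (kernel.lift h g w') := (ShortComplex.exact_iff_epi_kernel_lift _).1 e'
  have w2 : f ≫ kernel.lift h g w' = 0 := by
    rw [← cancel_mono (kernel.ι h)]; simp [w]
  let φ : ShortComplex.mk f (kernel.lift h g w') w2 ⟶ ShortComplex.mk f g w :=
    { τ₁ := 𝟙 _, τ₂ := 𝟙 _, τ₃ := kernel.ι h }
  have : Epi φ.τ₁ := inferInstanceAs (Epi (𝟙 _))
  have : IsIso φ.τ₂ := inferInstanceAs (IsIso (𝟙 _))
  have : Mono φ.τ₃ := inferInstanceAs (Mono (kernel.ι h))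
  have ex : (ShortComplex.mk f (kernel.lift h g w') w2).Exact :=
    (ShortComplex.exact_iff_of_epi_of_isIso_of_mono φ).2 e
  have : Epi (ShortComplex.mk f (kernel.lift h g w') w2).g := hepi
  exact ⟨(colimit.isColimit _).coconePointUniqueUpToIso ex.gIsCokernel⟩

namespace MResolution

variable {M : HoveyTriple.{w} C} {A : C} (WA : MResolution M A)

lemma exact' (i j k : ℤ) (hi : i = j + 1) (hk : k = j - 1) :
    (ShortComplex.mk (WA.c.d i j) (WA.c.d j k) (WA.c.d_comp_d _ _ _)).Exact := by
  subst hi hk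
  exact WA.exact j

lemma ses (i j k : ℤ) (hi : i = j + 1) (hk : k = j - 1) :
    (ShortComplex.mk (kernel.ι (WA.c.d i j))
      (kernel.lift (WA.c.d j k) (WA.c.d i j) (WA.c.d_comp_d _ _ _)) (by
      rw [← cancel_mono (kernel.ι (WA.c.d j k))]; simp)).ShortExact :=
  ses_of_exact _ _ _ (WA.exact' i j k hi hk)

lemma iso_A : Nonempty (A ≅ kernel (WA.c.d (-1) (-2))) := by
  have := WA.epi
  have := WA.mono
  have w : WA.η ≫ WA.c.d (-1) (-2) = 0 := by
    rw [← cancel_epi WA.ε, ← Category.assoc, ← WA.fac]; simp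
  let φ : ShortComplex.mk (WA.c.d 0 (-1)) (WA.c.d (-1) (-2)) (WA.c.d_comp_d _ _ _) ⟶
      ShortComplex.mk WA.η (WA.c.d (-1) (-2)) w :=
    { τ₁ := WA.ε, τ₂ := 𝟙 _, τ₃ := 𝟙 _, comm₁₂ := by simp [WA.fac] }
  have : Epi φ.τ₁ := WA.epi
  have : IsIso φ.τ₂ := inferInstanceAs (IsIso (𝟙 _))
  have : Mono φ.τ₃ := inferInstanceAs (Mono (𝟙 _))
  have ex := (ShortComplex.exact_iff_of_epi_of_isIso_of_mono φ).1
    (WA.exact' 0 (-1) (-2) (by norm_num) (by norm_num))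
  have : Mono (ShortComplex.mk WA.η (WA.c.d (-1) (-2)) w).f := WA.mono
  exact ⟨ex.fIsKernel.conePointUniqueUpToIso (limit.isLimit _)⟩

lemma cok_Q (n m : ℤ) (hn : n ≤ 0) (hm : m = n - 1) : M.Q (cokernel (WA.c.d n m)) := by
  have := WA.epi
  rcases hn.lt_or_eq with h | h
  · subst hm
    exact WA.cok_d n (by omega)
  · subst h
    obtain rfl : m = -1 := by omega
    rw [WA.fac]
    exact Q_of_iso M (cokernelEpiComp WA.ε WA.η).symm WA.cok_eta

lemma ker_Q_low (n m : ℤ) (hn : n ≤ -2) (hm : m = n - 1) : M.Q (kernel (WA.c.d n m)) := by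
  obtain ⟨e⟩ := coker_iso_ker _ _ _ _ _ (WA.exact' (n + 2) (n + 1) n (by omega) (by omega))
    (WA.exact' (n + 1) n m (by omega) (by omega))
  exact Q_of_iso M e (WA.cok_Q _ _ (by omega) (by omega))

lemma ker_Q (hA : M.Q A) (n m : ℤ) (hm : m = n - 1) : M.Q (kernel (WA.c.d n m)) := by
  by_cases hn : n ≤ -2
  · exact WA.ker_Q_low n m hn hm
  obtain ⟨k, rfl⟩ : ∃ k : ℕ, n = k - 1 := ⟨(n + 1).toNat, by omega⟩
  clear hn
  induction k generalizing m with
  | zero =>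
    obtain rfl : m = -2 := by simpa using hm
    obtain ⟨e⟩ := WA.iso_A
    simpa using Q_of_iso M e hA
  | succ k ih =>
    have hQ := ih (m - 1) (by omega)
    obtain rfl : m = k - 1 := by push_cast at hm; omega
    exact Q_kernel M (WA.ses _ _ _ (by push_cast; omega) rfl)
      (WA.comp_pos _ (by push_cast; omega)).1 hQ

end MResolution

lemma exists_of_splice (M : HoveyTriple.{w} C) (X Z : ℤ → C) (i : ∀ n, Z n ⟶ X n)
    (p : ∀ n, X (n + 1) ⟶ Z n) (w : ∀ n, i (n + 1) ≫ p n = 0)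
    (hS : ∀ n, (ShortComplex.mk (i (n + 1)) (p n) (w n)).ShortExact)
    (hpos : ∀ n : ℤ, 0 ≤ n → M.Q (X n) ∧ M.W (X n))
    (hneg : ∀ n : ℤ, n < 0 → M.W (X n) ∧ M.R (X n))
    (hR : ∀ n : ℤ, 0 ≤ n → M.R (Z n)) (hQ : ∀ n : ℤ, n ≤ -2 → M.Q (Z n)) :
    Nonempty (MResolution M (Z (-1))) := by
  have hp : ∀ n, Epi (p n) := fun n => (hS n).epi_g
  have hi' : ∀ n, Mono (i (n + 1)) := fun n => (hS n).mono_f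
  have hi : ∀ n, Mono (i n) := fun n => by
    obtain ⟨m, rfl⟩ : ∃ m, n = m + 1 := ⟨n - 1, by omega⟩
    exact hi' m
  have kerp : ∀ n, Nonempty (Z (n + 1) ≅ kernel (p n)) := fun n => by
    have := (hS n).mono_f
    exact ⟨(hS n).exact.fIsKernel.conePointUniqueUpToIso (limit.isLimit _)⟩
  have coki : ∀ n, Nonempty (cokernel (i (n + 1)) ≅ Z n) := fun n => by
    have := (hS n).epi_g
    exact ⟨(colimit.isColimit _).coconePointUniqueUpToIso (hS n).exact.gIsCokernel⟩
  have sq : ∀ n, (p (n + 1) ≫ i (n + 1)) ≫ p n ≫ i n = 0 := fun n => by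
    rw [Category.assoc, ← Category.assoc (i (n + 1)), w n]; simp
  let c : ChainComplex C ℤ := ChainComplex.of X (fun n => p n ≫ i n) sq
  have hd : ∀ n, c.d (n + 1) n = p n ≫ i n := fun n =>
    ChainComplex.of_d X (fun n => p n ≫ i n) n
  have hq : ∀ k : ℤ, k = -1 + 1 → ∃ q : X k ⟶ Z (-1), Epi q ∧ c.d k (-1) = q ≫ i (-1) ∧
      Nonempty (Z k ≅ kernel q) := by
    rintro _ rfl
    exact ⟨p (-1), hp (-1), hd (-1), kerp (-1)⟩
  have hc : ∀ k : ℤ, k = -2 + 1 → Nonempty (cokernel (i k) ≅ Z (-2)) := by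
    rintro _ rfl
    exact coki (-2)
  obtain ⟨q, hqe, hd0, ⟨eq⟩⟩ := hq 0 (by norm_num)
  refine ⟨{ c := c, ε := q, η := i (-1), epi := hqe, mono := hi (-1), fac := hd0,
            comp_pos := hpos, comp_neg := hneg, exact := ?_, ker_eps := ?_, ker_d := ?_,
            cok_eta := ?_, cok_d := ?_ }⟩
  · intro n
    obtain ⟨m, rfl⟩ : ∃ m, n = m + 1 := ⟨n - 1, by omega⟩
    have aux : ∀ k (hk : k = m), (ShortComplex.mk (c.d (m + 1 + 1) (m + 1)) (c.d (m + 1) k)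
        (c.d_comp_d _ _ _)).Exact := by
      rintro k rfl
      let S1 := ShortComplex.mk (c.d (k + 1 + 1) (k + 1)) (c.d (k + 1) k) (c.d_comp_d _ _ _)
      let S2 := ShortComplex.mk (i (k + 1)) (p k) (w k)
      let S3 := ShortComplex.mk (i (k + 1)) (c.d (k + 1) k)
        (by rw [hd, ← Category.assoc, w k, zero_comp])
      let φ : S1 ⟶ S3 :=
        { τ₁ := p (k + 1), τ₂ := 𝟙 (X (k + 1)), τ₃ := 𝟙 (X k)
          comm₁₂ := (hd (k + 1)).symm.trans (Category.comp_id _).symm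
          comm₂₃ := (Category.id_comp _).trans (Category.comp_id _).symm }
      let ψ : S2 ⟶ S3 :=
        { τ₁ := 𝟙 (Z (k + 1)), τ₂ := 𝟙 (X (k + 1)), τ₃ := i k
          comm₁₂ := (Category.id_comp _).trans (Category.comp_id _).symm
          comm₂₃ := (Category.id_comp _).trans (hd k) }
      have : Epi φ.τ₁ := hp (k + 1)
      have : IsIso φ.τ₂ := inferInstanceAs (IsIso (𝟙 _))
      have : Mono φ.τ₃ := inferInstanceAs (Mono (𝟙 _))
      have : Epi ψ.τ₁ := inferInstanceAs (Epi (𝟙 _))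
      have : IsIso ψ.τ₂ := inferInstanceAs (IsIso (𝟙 _))
      have : Mono ψ.τ₃ := hi k
      exact (ShortComplex.exact_iff_of_epi_of_isIso_of_mono φ).2
        ((ShortComplex.exact_iff_of_epi_of_isIso_of_mono ψ).1 (hS k).exact)
    exact aux _ (by omega)
  · exact R_of_iso M eq (hR 0 le_rfl)
  · intro n hn
    obtain ⟨m, rfl⟩ : ∃ m, n = m + 1 := ⟨n - 1, by omega⟩
    have aux : ∀ k (hk : k = m), M.R (kernel (c.d (m + 1) k)) := by
      rintro k rfl
      rw [hd]
      obtain ⟨e⟩ := kerp k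
      exact R_of_iso M (e ≪≫ (kernelCompMono (p k) (i k)).symm) (hR _ (by omega))
    exact aux _ (by omega)
  · obtain ⟨e⟩ := hc (-1) (by norm_num)
    exact Q_of_iso M e.symm (hQ _ le_rfl)
  · intro n hn
    obtain ⟨m, rfl⟩ : ∃ m, n = m + 1 + 1 := ⟨n - 2, by omega⟩
    have aux : ∀ k (hk : k = m + 1), M.Q (cokernel (c.d (m + 1 + 1) k)) := by
      rintro k rfl
      rw [hd]
      obtain ⟨e⟩ := coki m
      exact Q_of_iso M (cokernelEpiComp (p (m + 1)) (i (m + 1)) ≪≫ e).symm (hQ _ (by omega))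
    exact aux _ (by omega)

lemma exists_MResolution (M : HoveyTriple.{w} C) (A : C) : Nonempty (MResolution M A) := by
  choose K E i p w hQE hWE hRK hS using M.complete₂_proj
  choose E' K' i' p' w' hWE' hRE' hQK' hS' using M.complete₁_inj
  let Zp : ℕ → C := fun n => Nat.rec A (fun _ X => K X) n
  let Zn : ℕ → C := fun n => Nat.rec A (fun _ X => K' X) n
  let Z : ℤ → C := fun n => match n with
    | Int.ofNat n => Zp (n + 1)
    | Int.negSucc n => Zn n
  let X : ℤ → C := fun n => match n with
    | Int.ofNat n => E (Zp n)
    | Int.negSucc n => E' (Zn n)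
  let I : ∀ n, Z n ⟶ X n := fun n => match n with
    | Int.ofNat n => i (Zp n)
    | Int.negSucc n => i' (Zn n)
  let P : ∀ n, X (n + 1) ⟶ Z n := fun n => match n with
    | Int.ofNat n => p (Zp (n + 1))
    | Int.negSucc 0 => p A
    | Int.negSucc (n + 1) => p' (Zn n)
  have wz : ∀ n, I (n + 1) ≫ P n = 0 := fun n => match n with
    | Int.ofNat n => w (Zp (n + 1))
    | Int.negSucc 0 => w A
    | Int.negSucc (n + 1) => w' (Zn n)
  have hz : ∀ n, (ShortComplex.mk (I (n + 1)) (P n) (wz n)).ShortExact := fun n => match n with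
    | Int.ofNat n => hS (Zp (n + 1))
    | Int.negSucc 0 => hS A
    | Int.negSucc (n + 1) => hS' (Zn n)
  refine exists_of_splice M X Z I P wz hz ?_ ?_ ?_ ?_
  · rintro (n | n) hn
    · exact ⟨hQE _, hWE _⟩
    · omega
  · rintro (n | n) hn
    · exact absurd hn (by simp)
    · exact ⟨hWE' _, hRE' _⟩
  · rintro (n | n) hn
    · exact hRK _
    · omega
  · rintro (n | _ | n) hn
    · exact absurd hn (by simp; omega)
    · omega
    · exact hQK' _

end Helpers

/-- for an object `A`, the following are equivalent:
(1) `A` is cofibrant; (2) every cycle object of any `𝔐`-resolution of `A` is cofibrant;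
(3) `Hom(W_A, R)` is exact for every `𝔐`-resolution `W_A` of `A` and every trivially
fibrant `R`; (4) every component of any `𝔐`-resolution of `A` is trivially cofibrant. -/
theorem statement7 (M : HoveyTriple.{w} C) (A : C) :
    (M.Q A ↔ ∀ (WA : MResolution M A) (n : ℤ), M.Q (kernel (WA.c.d n (n - 1)))) ∧
    (M.Q A ↔ ∀ (WA : MResolution M A) (R : C), M.W R → M.R R →
        ∀ (n : ℤ) (f : WA.c.X n ⟶ R), WA.c.d (n + 1) n ≫ f = 0 →
          ∃ g : WA.c.X (n - 1) ⟶ R, f = WA.c.d n (n - 1) ≫ g) ∧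
    (M.Q A ↔ ∀ (WA : MResolution M A) (n : ℤ), M.Q (WA.c.X n) ∧ M.W (WA.c.X n)) := by
  have h12 : M.Q A → ∀ (WA : MResolution M A) (n : ℤ), M.Q (kernel (WA.c.d n (n - 1))) :=
    fun hA WA n => WA.ker_Q hA n _ rfl
  have h24 : (∀ (WA : MResolution M A) (n : ℤ), M.Q (kernel (WA.c.d n (n - 1)))) →
      ∀ (WA : MResolution M A) (n : ℤ), M.Q (WA.c.X n) ∧ M.W (WA.c.X n) := by
    intro H WA n
    refine ⟨Q_ext M (WA.ses n (n - 1) (n - 1 - 1) (by omega) rfl) (H WA n) (H WA (n - 1)), ?_⟩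
    by_cases hn : 0 ≤ n
    · exact (WA.comp_pos n hn).2
    · exact (WA.comp_neg n (by omega)).1
  obtain ⟨WA₀⟩ := exists_MResolution M A
  have h41 : (∀ (WA : MResolution M A) (n : ℤ), M.Q (WA.c.X n) ∧ M.W (WA.c.X n)) → M.Q A := by
    intro H
    obtain ⟨e⟩ := WA₀.iso_A
    refine Q_of_iso M e.symm ?_
    exact Q_kernel M (WA₀.ses (-1) (-2) (-3) (by norm_num) (by norm_num)) (H WA₀ (-1)).1
      (WA₀.ker_Q_low (-2) (-3) (by norm_num) (by norm_num))
  refine ⟨⟨h12, fun H => h41 (h24 H)⟩, ⟨?_, ?_⟩, ⟨fun h => h24 (h12 h), h41⟩⟩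
  · intro hA WA R hW hR n f hf
    have s1 := WA.ses n (n - 1) (n - 1 - 1) (by omega) rfl
    have s2 := WA.ses (n - 1) (n - 1 - 1) (n - 1 - 1 - 1) (by omega) rfl
    have : Subsingleton (Abelian.Ext (kernel (WA.c.d (n - 1 - 1) (n - 1 - 1 - 1))) R 1) :=
      M.orth₁ (WA.ker_Q hA _ _ rfl) hW hR
    have hE := WA.exact n
    have hk : kernel.ι (WA.c.d n (n - 1)) ≫ f = 0 := by
      have : Epi (kernel.lift (WA.c.d n (n - 1)) (WA.c.d (n + 1) n) (WA.c.d_comp_d _ _ _)) :=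
        (ShortComplex.exact_iff_epi_kernel_lift _).1 hE
      rw [← cancel_epi (kernel.lift (WA.c.d n (n - 1)) (WA.c.d (n + 1) n) (WA.c.d_comp_d _ _ _))]
      simpa using hf
    have := s1.epi_g
    let f' := s1.exact.desc f hk
    have hf' : kernel.lift (WA.c.d (n - 1) (n - 1 - 1)) (WA.c.d n (n - 1))
        (WA.c.d_comp_d _ _ _) ≫ f' = f := s1.exact.g_desc f hk
    obtain ⟨g, hg⟩ := extend_of_ext s2 f'
    refine ⟨g, ?_⟩
    dsimp at hg
    rw [← hf', ← hg]
    simp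
  · intro H
    obtain ⟨e⟩ := WA₀.iso_A
    refine Q_of_iso M e.symm ?_
    have s1 := WA₀.ses 0 (-1) (-2) (by norm_num) (by norm_num)
    have s2 := WA₀.ses 1 0 (-1) (by norm_num) (by norm_num)
    refine Q_of_extend M s1 (WA₀.comp_pos 0 le_rfl).1 ?_
    intro T hT hT' f
    dsimp at f
    obtain ⟨g, hg⟩ := H WA₀ T hT hT' 1
      (kernel.lift (WA₀.c.d 0 (-1)) (WA₀.c.d 1 0) (WA₀.c.d_comp_d _ _ _) ≫ f) (by
        rw [← Category.assoc]
        have : WA₀.c.d (1 + 1) 1 ≫ kernel.lift (WA₀.c.d 0 (-1)) (WA₀.c.d 1 0)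
          (WA₀.c.d_comp_d _ _ _) = 0 := by
          rw [← cancel_mono (kernel.ι (WA₀.c.d 0 (-1)))]; simp
        rw [this, zero_comp])
    refine ⟨g, ?_⟩
    have := s2.epi_g
    dsimp at this
    rw [← cancel_epi (kernel.lift (WA₀.c.d 0 (-1)) (WA₀.c.d 1 0) (WA₀.c.d_comp_d _ _ _))]
    dsimp
    rw [hg]
    simp
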